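/- Let K be a compact Hausdorff space and let f, g : K → ℝ be continuous nonnegative functions. Then the following are equivalent: (1) there exists c > 0 such that for all x ∈ K, f(x) > 0 implies g(x) > c; (2) the closure of {x ∈ K : f(x) ≠ 0} is contained in {x ∈ K : g(x) ≠ 0}. -/

import Mathlib

/-- For continuous nonnegative functions on a compact Hausdorff space, the
Gardella–Perera epsilon condition is equivalent to containment of the closure of the open
support of `f` in the open support of `g`. -/
theorem gardellaPerera_iff_support {K : Type*} [TopologicalSpace K] [CompactSpace K]
    [T2Space K] (f g : K → ℝ) (hf : Continuous f) (hg : Continuous g)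
    (hf0 : ∀ x, 0 ≤ f x) (hg0 : ∀ x, 0 ≤ g x) :
    (∃ c > (0 : ℝ), ∀ x, 0 < f x → c < g x) ↔
      closure {x : K | f x ≠ 0} ⊆ {x : K | g x ≠ 0} := by
  constructor
  · rintro ⟨c, hc, h⟩ x hx
    have hsub : closure {x : K | f x ≠ 0} ⊆ {x : K | c ≤ g x} :=
      closure_minimal (fun y hy => (h y ((hf0 y).lt_of_ne' hy)).le)
        (isClosed_le continuous_const hg)
    exact (hc.trans_le (hsub hx)).ne'
  · intro h
    obtain ⟨c, hc, hcg⟩ := isClosed_closure.isCompact.exists_forall_le'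
      (s := closure {x : K | f x ≠ 0}) hg.continuousOn
      (fun x hx => (hg0 x).lt_of_ne' (h hx))
    exact ⟨c / 2, half_pos hc, fun x hx =>
      (half_lt_self hc).trans_le (hcg x (subset_closure hx.ne'))⟩
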